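/- arXiv:2408.13246 — 2 statements merged into one kernel-verified Lean document; each statement's English description precedes it below -/
import Mathlib

section
/- Let ν, c, z ∈ ℂ with Re(ν) > −1. Then E_{ν,c}(z) = (z^ν / Γ(ν+1)) · ( 1 + ∑_{r=1}^∞ ((c z)^r / Γ(r)) · ∫₀¹ t^{r−1} (1−t)^ν dt ), where the integral is over real t ∈ (0,1) and (1−t)^ν denotes the principal complex power of the positive real number 1−t. -/
/-- The complex Miller-Ross function `E_{ν,c}(z) = z^ν ∑_{n=0}^∞ (cz)^n / Γ(ν+n+1)`,
using the principal complex power and the convention `1/Γ(m) = 0` at nonpositive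
integers `m` (in Mathlib `Complex.Gamma` vanishes there, and division by `0` is `0`). -/
noncomputable def millerRoss (ν c z : ℂ) : ℂ :=
  z ^ ν * ∑' n : ℕ, (c * z) ^ n / Complex.Gamma (ν + n + 1)

open Filter in
/-- The series defining the Miller-Ross function converges everywhere. -/
theorem summable_pow_div_Gamma (ν w : ℂ) :
    Summable fun n : ℕ => w ^ n / Complex.Gamma (ν + n + 1) := by
  refine summable_of_ratio_norm_eventually_le (r := 1 / 2) (by norm_num) ?_
  have hlim : Tendsto (fun n : ℕ => (n : ℝ)) atTop atTop := tendsto_natCast_atTop_atTop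
  filter_upwards [hlim.eventually_ge_atTop (2 * ‖w‖ + ‖ν + 1‖ + 1)] with n hn
  have hbound : 2 * ‖w‖ + 1 ≤ ‖ν + n + 1‖ := by
    have h := norm_sub_norm_le (n : ℂ) (-(ν + 1))
    rw [norm_neg, Complex.norm_natCast, show (n : ℂ) - -(ν + 1) = ν + n + 1 by ring] at h
    linarith
  have hpos : 0 < ‖ν + n + 1‖ := by linarith [norm_nonneg w]
  have hΓ : Complex.Gamma (ν + (n + 1 : ℕ) + 1) = (ν + n + 1) * Complex.Gamma (ν + n + 1) := by
    rw [← Complex.Gamma_add_one _ (norm_pos_iff.mp hpos)]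
    push_cast
    ring_nf
  rw [hΓ, pow_succ', mul_div_mul_comm, norm_mul, norm_div]
  refine mul_le_mul_of_nonneg_right ?_ (norm_nonneg _)
  rw [div_le_iff₀ hpos]
  linarith

/-- Euler's Beta integral with one natural-number exponent. -/
theorem integral_pow_mul_one_sub_cpow {ν : ℂ} (hν : -1 < ν.re) (s : ℕ) :
    ∫ t in (0:ℝ)..1, (t : ℂ) ^ s * ((1 : ℂ) - (t : ℂ)) ^ ν =
      Complex.Gamma ((s : ℂ) + 1) * Complex.Gamma (ν + 1) /
        Complex.Gamma (ν + (s + 1 : ℕ) + 1) := by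
  have hs : 0 < ((s : ℂ) + 1).re := by
    simp only [Complex.add_re, Complex.natCast_re, Complex.one_re]
    positivity
  have hν' : 0 < (ν + 1).re := by
    simp only [Complex.add_re, Complex.one_re]
    linarith
  have h := Complex.betaIntegral_eq_Gamma_mul_div _ _ hs hν'
  simp only [Complex.betaIntegral, add_sub_cancel_right, Complex.cpow_natCast] at h
  rw [h]
  congr 2
  push_cast
  ring

/-- Integral representation (Theorem 3.1, component form): for `Re ν > −1`,
`E_{ν,c}(z) = (z^ν/Γ(ν+1)) (1 + ∑_{r=1}^∞ ((cz)^r/Γ(r)) ∫₀¹ t^{r−1}(1−t)^ν dt)`;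
the sum over `r ≥ 1` is written with `r = s + 1`, `s ∈ ℕ`. -/
theorem millerRoss_integral_rep (ν c z : ℂ) (hν : -1 < ν.re) :
    millerRoss ν c z =
      z ^ ν / Complex.Gamma (ν + 1) *
        (1 + ∑' s : ℕ, (c * z) ^ (s + 1) / Complex.Gamma ((s : ℂ) + 1) *
          ∫ t in (0:ℝ)..1, (t : ℂ) ^ s * ((1 : ℂ) - (t : ℂ)) ^ ν) := by
  have hΓ : Complex.Gamma (ν + 1) ≠ 0 := by
    refine Complex.Gamma_ne_zero_of_re_pos ?_
    simp only [Complex.add_re, Complex.one_re]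
    linarith
  have hterm (s : ℕ) : (c * z) ^ (s + 1) / Complex.Gamma ((s : ℂ) + 1) *
      ∫ t in (0:ℝ)..1, (t : ℂ) ^ s * ((1 : ℂ) - (t : ℂ)) ^ ν =
      Complex.Gamma (ν + 1) * ((c * z) ^ (s + 1) / Complex.Gamma (ν + (s + 1 : ℕ) + 1)) := by
    have hs : Complex.Gamma ((s : ℂ) + 1) ≠ 0 := by
      rw [Complex.Gamma_nat_eq_factorial]
      exact_mod_cast s.factorial_ne_zero
    rw [integral_pow_mul_one_sub_cpow hν]
    field_simp
  rw [millerRoss, (summable_pow_div_Gamma ν (c * z)).tsum_eq_zero_add]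
  simp only [hterm, tsum_mul_left, pow_zero, Nat.cast_zero, add_zero]
  field_simp
end

section
/- Let ν, c ∈ ℂ. For every z ∈ ℂ lying off the nonpositive real axis (so in particular z ≠ 0), the function u(z) = E_{ν,c}(z) satisfies the second-order differential equation z · u''(z) + (1 − ν − c z) · u'(z) + (ν − 1) c · u(z) = 0, where u' and u'' are the first and second complex derivatives of E_{ν,c}. -/
open Filter in
/-- The power series with coefficients `1/Γ(ν+n+1)` converges absolutely everywhere. -/
lemma summable_norm_pow_div_Gamma (ν w : ℂ) :
    Summable fun n : ℕ => ‖w ^ n / Complex.Gamma (ν + n + 1)‖ := by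
  refine summable_norm_iff.mpr
    (summable_of_ratio_norm_eventually_le (r := 1 / 2) (by norm_num) ?_)
  filter_upwards [eventually_ge_atTop ⌈2 * ‖w‖ + ‖ν‖⌉₊] with n hn
  have hn' : 2 * ‖w‖ + ‖ν‖ ≤ n := Nat.ceil_le.mp hn
  have hrec := Complex.one_div_Gamma_eq_self_mul_one_div_Gamma_add_one (ν + n + 1)
  have hlow : 2 * ‖w‖ ≤ ‖ν + n + 1‖ := by
    have h := norm_sub_le (ν + n + 1) ν
    have h1 : ν + n + 1 - ν = ((n + 1 : ℕ) : ℂ) := by push_cast; ring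
    rw [h1, Complex.norm_natCast] at h
    push_cast at h
    linarith
  push_cast
  rw [← add_assoc ν (n : ℂ) 1, div_eq_mul_inv, div_eq_mul_inv (w ^ n), hrec, pow_succ]
  simp only [norm_mul]
  have := mul_le_mul_of_nonneg_right hlow
    (mul_nonneg (norm_nonneg (w ^ n)) (norm_nonneg (Complex.Gamma (ν + n + 1 + 1))⁻¹))
  linarith

/-- The entire function `S(w) = ∑ w^n / Γ(ν+n+1)` satisfies `w S' + ν S = w S + 1/Γ(ν)`. -/
lemma exists_hasDerivAt_tsum_pow_div_Gamma (ν w : ℂ) :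
    ∃ d : ℂ, HasDerivAt (fun w : ℂ => ∑' n : ℕ, w ^ n / Complex.Gamma (ν + n + 1)) d w ∧
      w * d + ν * ∑' n : ℕ, w ^ n / Complex.Gamma (ν + n + 1) =
        w * ∑' n : ℕ, w ^ n / Complex.Gamma (ν + n + 1) + (Complex.Gamma ν)⁻¹ := by
  have hu := summable_norm_pow_div_Gamma ν ((‖w‖ + 1 : ℝ) : ℂ)
  have hd (n : ℕ) : DifferentiableOn ℂ (fun w : ℂ => w ^ n / Complex.Gamma (ν + n + 1))
      (Metric.ball 0 (‖w‖ + 1)) := by fun_prop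
  have hle (n : ℕ) (y : ℂ) (hy : y ∈ Metric.ball (0 : ℂ) (‖w‖ + 1)) :
      ‖y ^ n / Complex.Gamma (ν + n + 1)‖ ≤
        ‖((‖w‖ + 1 : ℝ) : ℂ) ^ n / Complex.Gamma (ν + n + 1)‖ := by
    rw [mem_ball_zero_iff] at hy
    rw [norm_div, norm_div, norm_pow, norm_pow, Complex.norm_of_nonneg (by positivity)]
    gcongr
  have hw : w ∈ Metric.ball (0 : ℂ) (‖w‖ + 1) := by simp
  refine ⟨_, ((Complex.differentiableOn_tsum_of_summable_norm hu hd Metric.isOpen_ball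
    hle).differentiableAt (Metric.isOpen_ball.mem_nhds hw)).hasDerivAt, ?_⟩
  have hS := (summable_norm_pow_div_Gamma ν w).of_norm.hasSum
  have hL := ((Complex.hasSum_deriv_of_summable_norm hu hd Metric.isOpen_ball hle
    hw).mul_left w).add (hS.mul_left ν)
  refine hL.unique ?_
  rw [← hasSum_nat_add_iff' 1]
  convert! hS.mul_left w using 1
  · funext n
    have hrec := Complex.one_div_Gamma_eq_self_mul_one_div_Gamma_add_one (ν + n + 1)
    have hderiv := ((hasDerivAt_pow (n + 1) w).div_const
      (Complex.Gamma (ν + (n + 1 : ℕ) + 1))).deriv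
    rw [hderiv]
    push_cast
    simp only [← add_assoc, div_eq_mul_inv, hrec]
    ring
  · have hrec := Complex.one_div_Gamma_eq_self_mul_one_div_Gamma_add_one ν
    simp [hrec]

/-- On the slit plane, `E_{ν,c}' = c E_{ν,c} + z^(ν-1) / Γ(ν)`. -/
lemma hasDerivAt_millerRoss (ν c : ℂ) {z : ℂ} (hz : z ∈ Complex.slitPlane) :
    HasDerivAt (millerRoss ν c)
      (c * millerRoss ν c z + z ^ (ν - 1) * (Complex.Gamma ν)⁻¹) z := by
  obtain ⟨d, hd, hrec⟩ := exists_hasDerivAt_tsum_pow_div_Gamma ν (c * z)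
  have hz0 : z ≠ 0 := Complex.slitPlane_ne_zero hz
  have hp : HasDerivAt (fun z : ℂ => z ^ ν) (ν * z ^ (ν - 1)) z := by
    simpa using (hasDerivAt_id z).cpow_const (c := ν) hz
  have h := hp.mul (hd.comp z ((hasDerivAt_id z).const_mul c))
  refine h.congr_deriv ?_
  have hpow : z ^ ν = z ^ (ν - 1) * z := by
    rw [Complex.cpow_sub _ _ hz0, Complex.cpow_one, div_mul_cancel₀ _ hz0]
  simp only [millerRoss, Function.comp_apply, hpow]
  linear_combination z ^ (ν - 1) * hrec

/-- Theorem 4.3, component form: on the slit plane, `u = E_{ν,c}` satisfies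
`z u'' + (1 − ν − cz) u' + (ν − 1) c u = 0`. -/
theorem millerRoss_ode (ν c : ℂ) (z : ℂ) (hz : 0 < z.re ∨ z.im ≠ 0) :
    z * iteratedDeriv 2 (millerRoss ν c) z
      + (1 - ν - c * z) * deriv (millerRoss ν c) z
      + (ν - 1) * c * millerRoss ν c z = 0 := by
  have hs : z ∈ Complex.slitPlane := hz
  have hz0 : z ≠ 0 := Complex.slitPlane_ne_zero hs
  have h1 := hasDerivAt_millerRoss ν c hs
  have hev : deriv (millerRoss ν c) =ᶠ[nhds z]
      fun w => c * millerRoss ν c w + w ^ (ν - 1) * (Complex.Gamma ν)⁻¹ := by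
    filter_upwards [Complex.isOpen_slitPlane.mem_nhds hs] with w hw
    exact (hasDerivAt_millerRoss ν c hw).deriv
  have hp : HasDerivAt (fun w : ℂ => w ^ (ν - 1)) ((ν - 1) * z ^ (ν - 1 - 1)) z := by
    simpa using (hasDerivAt_id z).cpow_const (c := ν - 1) hs
  have h2 := (h1.const_mul c).fun_add (hp.mul_const (Complex.Gamma ν)⁻¹)
  have hpow : z ^ (ν - 1) = z ^ (ν - 1 - 1) * z := by
    rw [Complex.cpow_sub (ν - 1) _ hz0, Complex.cpow_one, div_mul_cancel₀ _ hz0]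
  rw [iteratedDeriv_succ, iteratedDeriv_one, hev.deriv_eq, h1.deriv, h2.deriv, hpow]
  ring
end
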